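/- arXiv:0907.2315 — 4 statements merged into one kernel-verified Lean document; each statement's English description precedes it below -/
import Mathlib

section
/- Assume Case 1. Then: (1) for every t ≥ 27, (s_(t+1,1),…,s_(t+1,93)) = (s_(t,69), s_(t,1),…,s_(t,92)), and consequently s_(t+69,j) = s_(t,j) for every t ≥ 27 and every 1 ≤ j ≤ 93; (2) for every t ≥ 27 and every 1 ≤ i ≤ 24, s_(t,69+i) = s_(t,i); (3) for every t ≥ 27 and every 162 ≤ j ≤ 288, s_(t,j) = 0. -/
/-- A Trivium state: we use coordinates 1,…,288 of a function `ℕ → ZMod 2`. -/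
abbrev TState := ℕ → ZMod 2

/-- The Trivium state-renewal map `T`. -/
def trivT (s : TState) : TState := fun j =>
  if j = 1 then s 243 + s 286 * s 287 + s 288 + s 69
  else if j ≤ 93 then s (j - 1)
  else if j = 94 then s 66 + s 91 * s 92 + s 93 + s 171
  else if j ≤ 177 then s (j - 1)
  else if j = 178 then s 162 + s 175 * s 176 + s 177 + s 264
  else if j ≤ 288 then s (j - 1)
  else 0

/-- `Z_F`: set every coordinate with index in `F` to zero. -/
def zapF (F : Finset ℕ) (s : TState) : TState := fun j => if j ∈ F then 0 else s j

/-- The loading state `L(k, IV)`: positions 1–93 are `(k_1,…,k_80,0,…,0)`,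
positions 94–177 are `(IV_1,…,IV_80,0,0,0,0)`, positions 178–288 are `(0,…,0,1,1,1)`. -/
def loadIV (k IV : TState) : TState := fun j =>
  if j = 0 then 0
  else if j ≤ 80 then k j
  else if j ≤ 93 then 0
  else if j ≤ 173 then IV (j - 93)
  else if j ≤ 285 then 0
  else if j ≤ 288 then 1
  else 0

/-- The fault-injected trajectory with initial vector `IV`:
`s^(0) = Z_F(L(k,IV))`, `s^(t+1) = Z_F(T(s^(t)))`. -/
def trajIV (F : Finset ℕ) (k IV : TState) : ℕ → TState
  | 0 => zapF F (loadIV k IV)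
  | t + 1 => zapF F (trivT (trajIV F k IV t))

/-- The fault-injected trajectory with `IV = 0`. -/
def traj (F : Finset ℕ) (k : TState) : ℕ → TState := trajIV F k (fun _ => 0)

/-- The key-stream with initial vector `IV`. -/
def ksIV (F : Finset ℕ) (k IV : TState) (m : ℕ) : ZMod 2 :=
  trajIV F k IV (m + 1152) 66 + trajIV F k IV (m + 1152) 93 + trajIV F k IV (m + 1152) 162 +
    trajIV F k IV (m + 1152) 177 + trajIV F k IV (m + 1152) 243 + trajIV F k IV (m + 1152) 288

/-- The key-stream with `IV = 0`. -/
def ks (F : Finset ℕ) (k : TState) : ℕ → ZMod 2 := ksIV F k (fun _ => 0)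

/-- `e_j` for `1 ≤ j ≤ 69`: `e_j = k_j` for `j ≤ 66`, `e_67 = k_67+1`, `e_68 = k_68+1`,
`e_69 = k_69`. -/
def ebase (k : TState) : ℕ → ZMod 2 := fun j =>
  if j ≤ 66 then k j else if j = 67 then k 67 + 1 else if j = 68 then k 68 + 1 else k 69

/-- `e` extended to all integer indices periodically with period 69. -/
def eper (k : TState) (i : ℤ) : ZMod 2 := ebase k (((i - 1).emod 69).toNat + 1)

/-- `a_n = s_(n-1,66) + s_(n-1,91)·s_(n-1,92) + s_(n-1,93)` for a natural number `n`. -/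
def aAt (F : Finset ℕ) (k : TState) (n : ℕ) : ZMod 2 :=
  traj F k (n - 1) 66 + traj F k (n - 1) 91 * traj F k (n - 1) 92 + traj F k (n - 1) 93

/-- The sequence `a_i` for integer `i`: `a_{t+1} = s_(t,66)+s_(t,91)s_(t,92)+s_(t,93)` for
`t ≥ 27`, and for `i ≤ 27`, `a_i = a_j` where `28 ≤ j ≤ 96` and `j ≡ i (mod 69)`. -/
def aFun (F : Finset ℕ) (k : TState) (i : ℤ) : ZMod 2 :=
  if 28 ≤ i then aAt F k i.toNat else aAt F k (28 + (i - 28).emod 69).toNat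

/-- `b_n = s_(n-1,162) + s_(n-1,175)·s_(n-1,176) + s_(n-1,177)` for a natural number `n`. -/
def bAt (F : Finset ℕ) (k : TState) (n : ℕ) : ZMod 2 :=
  traj F k (n - 1) 162 + traj F k (n - 1) 175 * traj F k (n - 1) 176 + traj F k (n - 1) 177

/-- The sequence `b_i` for integer `i`: `b_{t+1} = s_(t,162)+s_(t,175)s_(t,176)+s_(t,177)` for
`t ≥ 98`, and for `i ≤ 98`, `b_i = b_j` where `99 ≤ j ≤ 176` and `j ≡ i (mod 78)`. -/
def bFun (F : Finset ℕ) (k : TState) (i : ℤ) : ZMod 2 :=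
  if 99 ≤ i then bAt F k i.toNat else bAt F k (99 + (i - 99).emod 78).toNat

/-- The changed state at time 27 (Case 2, Lemma 6): coordinates 172–177 are replaced by
`s_(27,94)+a_27, …, s_(27,99)+a_22`; all other coordinates agree with `s^(27)`. -/
def sTildeBase (F : Finset ℕ) (k : TState) : TState := fun j =>
  if 172 ≤ j ∧ j ≤ 177 then traj F k 27 (j - 78) + aFun F k (199 - (j : ℤ))
  else traj F k 27 j

/-- The changed trajectory `s̃`: `s̃^(27)` is the changed state, and
`s̃^(t+1) = Z_F(T(s̃^(t)))` for `t ≥ 27`. (For `t ≤ 27`, `sTilde F k t = s̃^(27)`.) -/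
def sTilde (F : Finset ℕ) (k : TState) (t : ℕ) : TState :=
  (fun s => zapF F (trivT s))^[t - 27] (sTildeBase F k)

/-- The changed state at time 98 (Case 3, Lemma 11): coordinates 265–288 are replaced by
`s_(98,178)+b_98, …, s_(98,201)+b_75`; all other coordinates agree with `s^(98)`. -/
def sHatBase (F : Finset ℕ) (k : TState) : TState := fun j =>
  if 265 ≤ j ∧ j ≤ 288 then traj F k 98 (j - 87) + bFun F k (363 - (j : ℤ))
  else traj F k 98 j

/-- The changed trajectory `ŝ`: `ŝ^(98)` is the changed state, and
`ŝ^(t+1) = Z_F(T(ŝ^(t)))` for `t ≥ 98`. (For `t ≤ 98`, `sHat F k t = ŝ^(98)`.) -/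
def sHat (F : Finset ℕ) (k : TState) (t : ℕ) : TState :=
  (fun s => zapF F (trivT s))^[t - 98] (sHatBase F k)

/-- `aSeq t = a_{t+1} = s_(t,66) + s_(t,91)·s_(t,92) + s_(t,93)` for `t ≥ 0`. -/
def aSeq (F : Finset ℕ) (k : TState) (t : ℕ) : ZMod 2 :=
  traj F k t 66 + traj F k t 91 * traj F k t 92 + traj F k t 93

theorem traj_zero (F : Finset ℕ) (k : TState) :
    traj F k 0 = zapF F (loadIV k fun _ => 0) := rfl

theorem traj_succ (F : Finset ℕ) (k : TState) (t : ℕ) :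
    traj F k (t + 1) = zapF F (trivT (traj F k t)) := rfl

/-- Without faults in the first register, its first cell is fed as in the fault-free cipher. -/
theorem traj_succ_one {F : Finset ℕ} (hA : ∀ j ∈ F, 93 < j) {k : TState} {t : ℕ} :
    traj F k (t + 1) 1 =
      traj F k t 243 + traj F k t 286 * traj F k t 287 + traj F k t 288 + traj F k t 69 := by
  have h : 1 ∉ F := fun h => absurd (hA 1 h) (by norm_num)
  simp [traj_succ, zapF, trivT, h]

/-- Without faults in the first register, its content is shifted by one cell at each step. -/
theorem traj_succ_shift {F : Finset ℕ} (hA : ∀ j ∈ F, 93 < j) {k : TState} {t j : ℕ}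
    (h1 : 1 ≤ j) (h2 : j + 1 ≤ 93) : traj F k (t + 1) (j + 1) = traj F k t j := by
  have h : j + 1 ∉ F := fun h => absurd (hA _ h) (by omega)
  rw [traj_succ, zapF, if_neg h, trivT, if_neg (by omega), if_pos h2, Nat.add_sub_cancel]

/-- Without faults in the first register, its content is shifted by `n` cells in `n` steps. -/
theorem traj_add {F : Finset ℕ} (hA : ∀ j ∈ F, 93 < j) {k : TState} {t j : ℕ}
    (h1 : 1 ≤ j) (n : ℕ) (h2 : j + n ≤ 93) : traj F k (t + n) (j + n) = traj F k t j := by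
  induction n with
  | zero => rfl
  | succ n ih =>
    rw [← add_assoc, ← add_assoc, traj_succ_shift hA (by omega) (by omega), ih (by omega)]

/-- A fault at a position `p` of the second register with `p ≤ 162` keeps all cells from `p` on
equal to zero, except for the three ones loaded at the end of the third register, which leave it
within three steps. -/
theorem traj_eq_zero_of_mem {F : Finset ℕ} {k : TState} {p : ℕ} (hp : p ∈ F) (hlo : 94 ≤ p)
    (hhi : p ≤ 162) (t j : ℕ) (h1 : p ≤ j) (h2 : j ≤ 288) (h3 : j < 286 + t) :
    traj F k t j = 0 := by
  induction t generalizing j with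
  | zero =>
    simp only [traj_zero, zapF, loadIV]
    split_ifs <;> first | rfl | omega
  | succ t ih =>
    by_cases hj : j ∈ F
    · rw [traj_succ, zapF, if_pos hj]
    have hne : p ≠ j := fun h => hj (h ▸ hp)
    rw [traj_succ, zapF, if_neg hj, trivT, if_neg (by omega), if_neg (by omega),
      if_neg (by omega)]
    split_ifs with h177 h178
    · exact ih _ (by omega) (by omega) (by omega)
    · rw [ih 162 hhi (by norm_num) (by omega), ih 175 (by omega) (by norm_num) (by omega),
        ih 177 (by omega) (by norm_num) (by omega),
        ih 264 (by omega) (by norm_num) (by omega)]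
      ring
    · exact ih _ (by omega) (by omega) (by omega)

/-- Lemma 3 (Case 1). -/
theorem case1_register_structure (k : TState) (F : Finset ℕ) (hF : F.Nonempty)
    (hsub : F ⊆ Finset.Icc 94 177)
    (hlo : 94 ≤ F.min' hF) (hhi : F.min' hF ≤ 162) :
    ((∀ t, 27 ≤ t →
        traj F k (t + 1) 1 = traj F k t 69 ∧
        (∀ j, 2 ≤ j → j ≤ 93 → traj F k (t + 1) j = traj F k t (j - 1))) ∧
      (∀ t, 27 ≤ t → ∀ j, 1 ≤ j → j ≤ 93 → traj F k (t + 69) j = traj F k t j)) ∧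
    (∀ t, 27 ≤ t → ∀ i, 1 ≤ i → i ≤ 24 → traj F k t (69 + i) = traj F k t i) ∧
    (∀ t, 27 ≤ t → ∀ j, 162 ≤ j → j ≤ 288 → traj F k t j = 0) := by
  have hm : F.min' hF ∈ F := F.min'_mem hF
  have hA : ∀ j ∈ F, 93 < j := fun j hj => by
    have := Finset.mem_Icc.mp (hsub hj)
    omega
  have hC : ∀ t, 3 ≤ t → ∀ j, 162 ≤ j → j ≤ 288 → traj F k t j = 0 := fun t ht j h1 h2 =>
    traj_eq_zero_of_mem hm hlo hhi t j (hhi.trans h1) h2 (by omega)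
  have hone : ∀ t, 3 ≤ t → traj F k (t + 1) 1 = traj F k t 69 := fun t ht => by
    rw [traj_succ_one hA, hC t ht 243 (by norm_num) (by norm_num),
      hC t ht 286 (by norm_num) (by norm_num), hC t ht 288 (by norm_num) (by norm_num)]
    ring
  have hrot : ∀ t j, 1 ≤ j → j ≤ 93 → 3 ≤ t → traj F k (t + j) j = traj F k t 69 :=
    fun t j h1 h2 ht => by
      obtain ⟨n, rfl⟩ := Nat.exists_eq_add_of_le h1
      rw [← add_assoc, traj_add hA le_rfl n h2, hone t ht]
  have hfold : ∀ t, 27 ≤ t → ∀ i, 1 ≤ i → i ≤ 24 → traj F k t (69 + i) = traj F k t i :=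
    fun t ht i h1 h2 => by
      obtain ⟨u, rfl⟩ := Nat.exists_eq_add_of_le' (show i ≤ t by omega)
      rw [traj_add hA (by norm_num) i (by omega), hrot u i h1 (by omega) (by omega)]
  have hper : ∀ t, 27 ≤ t → ∀ j, 1 ≤ j → j ≤ 69 → traj F k (t + 69) j = traj F k t j :=
    fun t ht j h1 h2 => by
      obtain ⟨n, hn⟩ := Nat.exists_eq_add_of_le h2
      rw [show t + 69 = t + n + j by omega, hrot (t + n) j h1 (by omega) (by omega), hn,
        traj_add hA h1 n (by omega)]
  refine ⟨⟨fun t ht => ⟨hone t (by omega), fun j h1 h2 => ?_⟩, fun t ht j h1 h2 => ?_⟩,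
    hfold, fun t ht => hC t (by omega)⟩
  · obtain ⟨i, rfl⟩ := Nat.exists_eq_add_of_le' (show 1 ≤ j by omega)
    exact traj_succ_shift hA (by omega) h2
  · rcases Nat.lt_or_ge 69 j with h | h
    · obtain ⟨i, rfl⟩ := Nat.exists_eq_add_of_le h.le
      rw [hfold t ht i (by omega) (by omega), hfold (t + 69) (by omega) i (by omega) (by omega),
        hper t ht i (by omega) (by omega)]
    · exact hper t ht j h1 h
end

section
/- Assume Case 2, and let s̃ denote the changed trajectory. Then for every t ≥ 27 and every j with 94 ≤ j ≤ 177, s̃_(t+78,j) = s̃_(t,j) + a_{t+172-j}. -/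
theorem trajIV_eq_zero_of_fault_le {F : Finset ℕ} {p : ℕ} (hp : p ∈ F) (hlo : 178 ≤ p)
    (k IV : TState) (t : ℕ) :
    ∀ j, p ≤ j → (j < 286 + t ∨ 288 < j) → trajIV F k IV t j = 0 := by
  induction t with
  | zero =>
    intro j hj hjt
    simp only [trajIV, zapF, loadIV]
    split_ifs <;> first | rfl | omega
  | succ t ih =>
    intro j hj hjt
    simp only [trajIV, zapF, trivT]
    split_ifs with hjF <;> first | rfl | omega | skip
    · exact absurd (by grind) hjF
    · have : j ≠ p := fun h => hjF (h ▸ hp)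
      exact ih _ (by omega) (by omega)

theorem sTilde_base (F : Finset ℕ) (k : TState) : sTilde F k 27 = sTildeBase F k := rfl

theorem sTilde_succ (F : Finset ℕ) (k : TState) {t : ℕ} (ht : 27 ≤ t) :
    sTilde F k (t + 1) = zapF F (trivT (sTilde F k t)) := by
  rw [sTilde, Nat.sub_add_comm ht, Function.iterate_succ_apply', sTilde]

theorem sTilde_eq_zero_of_fault_le {F : Finset ℕ} {p : ℕ} (hp : p ∈ F) (hlo : 178 ≤ p)
    (k : TState) {t : ℕ} (ht : 27 ≤ t) :
    ∀ j, p ≤ j → sTilde F k t j = 0 := by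
  induction t, ht using Nat.le_induction with
  | base =>
    intro j hj
    rw [sTilde_base, sTildeBase, if_neg (by omega)]
    exact trajIV_eq_zero_of_fault_le hp hlo k _ 27 j hj (by omega)
  | succ t ht ih =>
    intro j hj
    rw [sTilde_succ F k ht]
    simp only [zapF, trivT]
    split_ifs with hjF <;> first | rfl | omega | skip
    · exact absurd (by grind) hjF
    · have : j ≠ p := fun h => hjF (h ▸ hp)
      exact ih _ (by omega)

theorem sTilde_eq_traj {F : Finset ℕ} {p : ℕ} (hp : p ∈ F) (hlo : 178 ≤ p) (hhi : p ≤ 243)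
    (k : TState) {t : ℕ} (ht : 27 ≤ t) :
    ∀ j, 1 ≤ j → j ≤ 93 → sTilde F k t j = traj F k t j := by
  induction t, ht using Nat.le_induction with
  | base =>
    intro j _ hj
    rw [sTilde_base, sTildeBase, if_neg (by omega)]
  | succ t ht ih =>
    intro j hj1 hj
    have hz := sTilde_eq_zero_of_fault_le hp hlo k ht
    have hz' : ∀ i, p ≤ i → traj F k t i = 0 := fun i hi =>
      trajIV_eq_zero_of_fault_le hp hlo k _ t i hi (by omega)
    have hstep : traj F k (t + 1) = zapF F (trivT (traj F k t)) := rfl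
    rw [sTilde_succ F k ht, hstep]
    simp only [zapF, trivT, hj, if_true]
    split_ifs
    · rfl
    · rw [hz 243 hhi, hz 286 (by omega), hz 288 (by omega), hz' 243 hhi, hz' 286 (by omega),
        hz' 288 (by omega), ih 69 (by omega) (by omega)]
      ring
    · exact ih _ (by omega) (by omega)

theorem sTilde_add_shift {F : Finset ℕ} (hsub : F ⊆ Finset.Icc 178 288) (k : TState)
    {t j : ℕ} (ht : 27 ≤ t) (hj : 94 ≤ j) (n : ℕ) (hjn : j + n ≤ 177) :
    sTilde F k (t + n) (j + n) = sTilde F k t j := by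
  induction n with
  | zero => rfl
  | succ n ih =>
    have hF : j + (n + 1) ∉ F := fun h => by
      have := Finset.mem_Icc.mp (hsub h)
      omega
    rw [← ih (by omega), ← Nat.add_assoc t, sTilde_succ F k (by omega), zapF, if_neg hF, trivT,
      if_neg (by omega), if_neg (by omega), if_neg (by omega), if_pos hjn]
    rfl

theorem sTilde_succ_apply_ninety_four {F : Finset ℕ} (hsub : F ⊆ Finset.Icc 178 288) {p : ℕ}
    (hp : p ∈ F) (hhi : p ≤ 243) (k : TState) {t : ℕ} (ht : 27 ≤ t) :
    sTilde F k (t + 1) 94 = aAt F k (t + 1) + sTilde F k t 171 := by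
  have hlo : 178 ≤ p := (Finset.mem_Icc.mp (hsub hp)).1
  have hF : 94 ∉ F := fun h => by
    have := Finset.mem_Icc.mp (hsub h)
    omega
  have hA := sTilde_eq_traj hp hlo hhi k ht
  rw [sTilde_succ F k ht, zapF, if_neg hF, trivT, if_neg (by decide), if_neg (by decide),
    if_pos rfl, hA 66 (by decide) (by decide), hA 91 (by decide) (by decide),
    hA 92 (by decide) (by decide), hA 93 (by decide) (by decide), aAt, Nat.add_sub_cancel]

/-- Lemma 7 (Case 2). -/
theorem case2_period78_shift (k : TState) (F : Finset ℕ) (hF : F.Nonempty)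
    (hsub : F ⊆ Finset.Icc 178 288)
    (hlo : 178 ≤ F.min' hF) (hhi : F.min' hF ≤ 243) :
    ∀ t, 27 ≤ t → ∀ j, 94 ≤ j → j ≤ 177 →
      sTilde F k (t + 78) j = sTilde F k t j + aFun F k ((t : ℤ) + 172 - (j : ℤ)) := by
  have hp := F.min'_mem hF
  intro t ht
  induction t, ht using Nat.le_induction with
  | base =>
    intro j hj1 hj2
    by_cases hj : 172 ≤ j
    · obtain ⟨i, rfl⟩ := Nat.exists_eq_add_of_le' (show 78 ≤ j by omega)
      rw [sTilde_add_shift hsub k le_rfl (by omega) 78 hj2, sTilde_base, sTildeBase, sTildeBase,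
        if_neg (by omega), if_pos ⟨hj, hj2⟩, Nat.add_sub_cancel, add_assoc]
      norm_num [CharTwo.add_self_eq_zero]
    · obtain ⟨m, rfl⟩ := Nat.exists_eq_add_of_le hj1
      obtain ⟨n, hn⟩ := Nat.exists_eq_add_of_le (show m ≤ 77 by omega)
      have h1 := sTilde_add_shift hsub k (t := 27 + n + 1) (j := 94) (by omega) le_rfl m hj2
      have h2 := sTilde_add_shift hsub k (t := 27) le_rfl hj1 n (by omega)
      rw [show 94 + m + n = 171 by omega] at h2
      rw [show 27 + n + 1 + m = 27 + 78 by omega,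
        sTilde_succ_apply_ninety_four hsub hp hhi k (by omega), h2] at h1
      rw [h1, aFun, if_pos (by omega), add_comm,
        show (((27 : ℕ) : ℤ) + 172 - ((94 + m : ℕ) : ℤ)).toNat = 27 + n + 1 by omega]
  | succ t ht ih =>
    intro j hj1 hj2
    rcases hj1.eq_or_lt with rfl | hj
    · have h1 := sTilde_add_shift hsub k (t := t + 1) (j := 94) (by omega) le_rfl 77 (by omega)
      rw [show t + 1 + 78 = (t + 1 + 77) + 1 by omega,
        sTilde_succ_apply_ninety_four hsub hp hhi k (by omega), h1, aFun, if_pos (by omega),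
        show (((t + 1 : ℕ) : ℤ) + 172 - ((94 : ℕ) : ℤ)).toNat = t + 1 + 77 + 1 by omega,
        add_comm]
    · obtain ⟨i, rfl⟩ := Nat.exists_eq_add_of_le' (show 1 ≤ j by omega)
      rw [show t + 1 + 78 = t + 78 + 1 by omega,
        sTilde_add_shift hsub k (by omega) (by omega) 1 hj2,
        sTilde_add_shift hsub k ht (by omega) 1 hj2, ih i (by omega) (by omega),
        show ((t + 1 : ℕ) : ℤ) + 172 - ((i + 1 : ℕ) : ℤ) = (t : ℤ) + 172 - (i : ℤ) by omega]
end

section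
/- Assume Case 3, and let ŝ denote the changed trajectory. Then: (1) for every t ≥ 122 and every j with 66 ≤ j ≤ 288, ŝ_(t,j) = s_(t,j); (2) the key-stream is unchanged: for every m ≥ 0, ŝ_(m+1152,66) + ŝ_(m+1152,93) + ŝ_(m+1152,162) + ŝ_(m+1152,177) + ŝ_(m+1152,243) + ŝ_(m+1152,288) = z_m. -/
/-- If two states agree on the coordinates from `p ∈ F` up to (but excluding) `b > 264`, then after
one faulty clock they agree up to (but excluding) `b + 1`: what enters at coordinate 1 never
passes the stuck coordinate `p`. -/
lemma zapF_trivT_congr {F : Finset ℕ} {p b : ℕ} (hpF : p ∈ F) (hp1 : 1 ≤ p) (hp : p ≤ 66)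
    (hb : 264 < b) {u v : TState} (huv : ∀ j, p ≤ j → j ≤ 288 → j < b → u j = v j)
    (j : ℕ) (hpj : p ≤ j) (hj : j ≤ 288) (hjb : j < b + 1) :
    zapF F (trivT u) j = zapF F (trivT v) j := by
  unfold zapF
  split_ifs with hjF
  · rfl
  have hne : j ≠ p := fun h => hjF (h ▸ hpF)
  have hprev : u (j - 1) = v (j - 1) := huv _ (by omega) (by omega) (by omega)
  have hfix : ∀ i, 66 ≤ i → i ≤ 264 → u i = v i := fun i h₁ h₂ =>
    huv i (by omega) (by omega) (by omega)
  have hj1 : j ≠ 1 := by omega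
  simp only [trivT, hj1, if_false, hprev, hfix 66 (by norm_num) (by norm_num),
    hfix 91 (by norm_num) (by norm_num), hfix 92 (by norm_num) (by norm_num),
    hfix 93 (by norm_num) (by norm_num), hfix 171 (by norm_num) (by norm_num),
    hfix 162 (by norm_num) (by norm_num), hfix 175 (by norm_num) (by norm_num),
    hfix 176 (by norm_num) (by norm_num), hfix 177 (by norm_num) (by norm_num),
    hfix 264 (by norm_num) (by norm_num)]

lemma sHat_succ (F : Finset ℕ) (k : TState) (n : ℕ) :
    sHat F k (98 + (n + 1)) = zapF F (trivT (sHat F k (98 + n))) := by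
  simp only [sHat, Nat.add_sub_cancel_left, Function.iterate_succ_apply']

lemma sHat_eq_traj {F : Finset ℕ} (k : TState) {p : ℕ} (hpF : p ∈ F) (hp1 : 1 ≤ p) (hp : p ≤ 66)
    (n : ℕ) : ∀ j, p ≤ j → j ≤ 288 → j < 265 + n → sHat F k (98 + n) j = traj F k (98 + n) j := by
  induction n with
  | zero =>
    intro j _ _ hj
    have : ¬ (265 ≤ j ∧ j ≤ 288) := by omega
    simp [sHat, sHatBase, this]
  | succ n ih =>
    rw [sHat_succ]
    exact zapF_trivT_congr hpF hp1 hp (show 264 < 265 + n by omega) ih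

/-- Lemma 11 (Case 3): the changed trajectory agrees with the original one on
coordinates 66–288 from time 122 on, and the key-stream is unchanged. -/
theorem case3_changed_trajectory (k : TState) (F : Finset ℕ) (hF : F.Nonempty)
    (hsub : F ⊆ Finset.Icc 1 93)
    (hlo : 1 ≤ F.min' hF) (hhi : F.min' hF ≤ 66) :
    (∀ t, 122 ≤ t → ∀ j, 66 ≤ j → j ≤ 288 → sHat F k t j = traj F k t j) ∧
    (∀ m : ℕ,
        sHat F k (m + 1152) 66 + sHat F k (m + 1152) 93 + sHat F k (m + 1152) 162 +
          sHat F k (m + 1152) 177 + sHat F k (m + 1152) 243 + sHat F k (m + 1152) 288 =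
          ks F k m) := by
  have key : ∀ t, 122 ≤ t → ∀ j, 66 ≤ j → j ≤ 288 → sHat F k t j = traj F k t j := by
    intro t ht j hj₁ hj₂
    obtain ⟨n, rfl⟩ := Nat.exists_eq_add_of_le (show 98 ≤ t by omega)
    exact sHat_eq_traj k (F.min'_mem hF) hlo hhi n j (by omega) hj₂ (by omega)
  refine ⟨key, fun m => ?_⟩
  have hm : 122 ≤ m + 1152 := by omega
  rw [key _ hm 66, key _ hm 93, key _ hm 162, key _ hm 177, key _ hm 243, key _ hm 288]
  · rfl
  all_goals norm_num
end

section
/- (Proposition 5) Assume Case 3. Define a_{t+1} = s_(t,66) + s_(t,91)·s_(t,92) + s_(t,93) for every t ≥ 0. Suppose a_{t+1} = 1 for some t with 67 ≤ t ≤ 91. Then: (1) a_{i+1} = k_{66-i} for every 0 ≤ i ≤ 11 (i.e. (a_1,…,a_12) = (k_66,…,k_55)); (2) a_13 = k_54 + k_79·k_80; (3) either (a) a_{u+1} = k_{66-u} + k_{91-u}·k_{92-u} + k_{93-u} for every u with 13 ≤ u ≤ t-27 and a_{v+1} = k_{91-v}·k_{92-v} + k_{93-v} for every v with 65 ≤ v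 ≤ t-2, or (b) a_{u+1} = k_{66-u} + k_{91-u}·k_{92-u} for every u with 13 ≤ u ≤ t-27 and a_{v+1} = k_{91-v}·k_{92-v} for every v with 65 ≤ v ≤ t-2. -/
/-- Inside the first register the faulty trajectory shifts by one place and is then masked. -/
lemma traj_succ_of_le (F : Finset ℕ) (k : TState) (t : ℕ) {j : ℕ} (h1 : 1 < j) (h2 : j ≤ 93) :
    traj F k (t + 1) j = if j ∈ F then 0 else traj F k t (j - 1) := by
  simp only [traj, trajIV, zapF, trivT]
  rw [if_neg (by omega : ¬ j = 1), if_pos h2]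

/-- A position of the first register vanishes once its content has passed a faulty position. -/
lemma traj_eq_zero_of_mem_s16 (F : Finset ℕ) (k : TState) {i : ℕ} (hi : i ∈ F) (hi1 : 1 ≤ i) :
    ∀ {t j : ℕ}, i ≤ j → j ≤ 93 → j ≤ t + i → traj F k t j = 0 := by
  intro t
  induction t with
  | zero =>
    intro j h1 _ h3
    obtain rfl : j = i := by omega
    simp [traj, trajIV, zapF, hi]
  | succ t ih =>
    intro j h1 h2 h3
    rcases h1.eq_or_lt with rfl | h
    · simp [traj, trajIV, zapF, hi]
    · rw [traj_succ_of_le F k t (by omega) h2, ih (by omega) (by omega) (by omega), ite_self]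

/-- A loaded bit that meets no faulty position is shifted unchanged along the first register. -/
lemma traj_eq_load (F : Finset ℕ) (k : TState) :
    ∀ {t j : ℕ}, t < j → j ≤ 93 → (∀ i ∈ F, j - t ≤ i → j < i) →
      traj F k t j = loadIV k (fun _ => 0) (j - t) := by
  intro t
  induction t with
  | zero =>
    intro j _ _ h3
    have hj : j ∉ F := fun h => absurd (h3 j h (by omega)) (by omega)
    simp [traj, trajIV, zapF, hj]
  | succ t ih =>
    intro j h1 h2 h3
    have hj : j ∉ F := fun h => absurd (h3 j h (by omega)) (by omega)
    rw [traj_succ_of_le F k t (by omega) h2, if_neg hj, ih (by omega) (by omega)]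
    · rw [show j - 1 - t = j - (t + 1) by omega]
    · intro i hi h
      have := h3 i hi (by omega)
      omega

lemma loadIV_eq_key (k IV : TState) {j : ℕ} (h1 : 1 ≤ j) (h2 : j ≤ 80) : loadIV k IV j = k j := by
  rw [loadIV, if_neg (by omega), if_pos h2]

lemma loadIV_eq_zero (k IV : TState) {j : ℕ} (h1 : 80 < j) (h2 : j ≤ 93) : loadIV k IV j = 0 := by
  rw [loadIV, if_neg (by omega), if_neg (by omega), if_pos h2]

/-- Positions 81–93 are loaded with zeros, so they vanish until key bits arrive. -/
lemma traj_eq_zero_of_load (F : Finset ℕ) (k : TState) (hF : ∀ i ∈ F, 1 ≤ i) {t j : ℕ}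
    (h1 : 80 + t < j) (h2 : j ≤ 93) : traj F k t j = 0 := by
  by_cases h : ∀ i ∈ F, j - t ≤ i → j < i
  · rw [traj_eq_load F k (by omega) h2 h, loadIV_eq_zero _ _ (by omega) (by omega)]
  · push Not at h
    obtain ⟨i, hi, h3, h4⟩ := h
    exact traj_eq_zero_of_mem_s16 F k hi (hF i hi) h4 h2 (by omega)

lemma traj_eq_key (F : Finset ℕ) (k : TState) {t j : ℕ} (h0 : t < j) (h1 : j ≤ 80 + t)
    (h2 : j ≤ 93) (hF : ∀ i ∈ F, j - t ≤ i → j < i) : traj F k t j = k (j - t) := by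
  rw [traj_eq_load F k h0 h2 hF, loadIV_eq_key _ _ (by omega) (by omega)]

/-- If the taps 91–93 produce a one at time `t`, no fault lies on the path to position 92. -/
lemma not_mem_path_of_taps (F : Finset ℕ) (k : TState) (hF : ∀ i ∈ F, 1 ≤ i) {t : ℕ}
    (h : traj F k t 91 * traj F k t 92 + traj F k t 93 = 1) :
    ∀ i ∈ F, 93 - t ≤ i → 92 < i := by
  intro i hi h1
  by_contra! h2
  have h93 := traj_eq_zero_of_mem_s16 F k hi (hF i hi) (t := t) (j := 93)
    (by omega) le_rfl (by omega)
  have h92 := traj_eq_zero_of_mem_s16 F k hi (hF i hi) (t := t) (j := 92)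
    h2 (by omega) (by omega)
  simp [h93, h92] at h

/-- Proposition 5 (Case 3), with `aSeq t = a_{t+1}`. -/
theorem case3_prop5 (k : TState) (F : Finset ℕ) (hF : F.Nonempty)
    (hsub : F ⊆ Finset.Icc 1 93)
    (hlo : 1 ≤ F.min' hF) (hhi : F.min' hF ≤ 66)
    (t : ℕ) (ht1 : 67 ≤ t) (ht2 : t ≤ 91) (ha : aSeq F k t = 1) :
    (∀ i, i ≤ 11 → aSeq F k i = k (66 - i)) ∧
    aSeq F k 12 = k 54 + k 79 * k 80 ∧
    (((∀ u, 13 ≤ u → u ≤ t - 27 →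
          aSeq F k u = k (66 - u) + k (91 - u) * k (92 - u) + k (93 - u)) ∧
      (∀ v, 65 ≤ v → v ≤ t - 2 →
          aSeq F k v = k (91 - v) * k (92 - v) + k (93 - v))) ∨
     ((∀ u, 13 ≤ u → u ≤ t - 27 →
          aSeq F k u = k (66 - u) + k (91 - u) * k (92 - u)) ∧
      (∀ v, 65 ≤ v → v ≤ t - 2 →
          aSeq F k v = k (91 - v) * k (92 - v)))) := by
  have hpos : ∀ i ∈ F, 1 ≤ i := fun i hi => (Finset.mem_Icc.mp (hsub hi)).1
  have hz66 : ∀ v, 65 ≤ v → traj F k v 66 = 0 := fun v hv =>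
    traj_eq_zero_of_mem_s16 F k (F.min'_mem hF) hlo hhi (by omega) (by omega)
  have hpath := not_mem_path_of_taps F k hpos
    (by simpa [aSeq, hz66 t (by omega)] using ha)
  have key : ∀ {u j}, j ≤ 92 → u < j → j ≤ 80 + u → j + t ≥ 93 + u → traj F k u j = k (j - u) := by
    intro u j h1 h2 h3 h4
    refine traj_eq_key F k h2 h3 (by omega) fun i hi h => ?_
    have := hpath i hi (by omega)
    omega
  refine ⟨fun i hi => ?_, ?_, ?_⟩
  · rw [aSeq, traj_eq_zero_of_load F k hpos (j := 92) (by omega) (by omega),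
      traj_eq_zero_of_load F k hpos (j := 93) (by omega) le_rfl,
      key (by omega) (by omega) (by omega) (by omega), mul_zero, add_zero, add_zero]
  · rw [aSeq, traj_eq_zero_of_load F k hpos (j := 93) (by omega) le_rfl,
      key (by omega) (by omega) (by omega) (by omega),
      key (by omega) (by omega) (by omega) (by omega),
      key (by omega) (by omega) (by omega) (by omega), add_zero]
  · by_cases h93 : 93 ∈ F
    · have hz93 : ∀ u, traj F k u 93 = 0 := fun u =>
        traj_eq_zero_of_mem_s16 F k h93 (by omega) le_rfl le_rfl (by omega)
      refine Or.inr ⟨fun u h1 h2 => ?_, fun v h1 h2 => ?_⟩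
      · rw [aSeq, hz93, key (by omega) (by omega) (by omega) (by omega),
          key (by omega) (by omega) (by omega) (by omega),
          key (by omega) (by omega) (by omega) (by omega), add_zero]
      · rw [aSeq, hz93, hz66 v h1, key (by omega) (by omega) (by omega) (by omega),
          key (by omega) (by omega) (by omega) (by omega), add_zero, zero_add]
    · have key93 : ∀ {u}, 13 ≤ u → u ≤ t → traj F k u 93 = k (93 - u) := by
        intro u h1 h2
        refine traj_eq_key F k (by omega) (by omega) le_rfl fun i hi h => ?_
        have := hpath i hi (by omega)
        have : i ≠ 93 := fun e => h93 (e ▸ hi)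
        omega
      refine Or.inl ⟨fun u h1 h2 => ?_, fun v h1 h2 => ?_⟩
      · rw [aSeq, key93 h1 (by omega), key (by omega) (by omega) (by omega) (by omega),
          key (by omega) (by omega) (by omega) (by omega),
          key (by omega) (by omega) (by omega) (by omega)]
      · rw [aSeq, key93 (by omega) (by omega), hz66 v h1,
          key (by omega) (by omega) (by omega) (by omega),
          key (by omega) (by omega) (by omega) (by omega), zero_add]
end
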